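/- For every instance of the related machine scheduling game, every pure Nash equilibrium τ and every schedule σ satisfy SC(τ) ≤ 2·SC(σ). In particular, the pure price of anarchy of Q||ΣC_j is at most 2. -/

import Mathlib

open Finset

/-- Completion time of job `j` under schedule `τ`: jobs are processed in SPT order
(ties broken by index), so `C_j(τ) = (∑_{k ≤ j, τ_k = τ_j} p_k) / s_{τ_j}`. -/
noncomputable def completionTime {n m : ℕ} (p : Fin n → ℝ) (s : Fin m → ℝ)
    (τ : Fin n → Fin m) (j : Fin n) : ℝ :=
  (∑ k ∈ univ.filter (fun k => k ≤ j ∧ τ k = τ j), p k) / s (τ j)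

/-- Social cost: sum of completion times. -/
noncomputable def socialCost {n m : ℕ} (p : Fin n → ℝ) (s : Fin m → ℝ)
    (τ : Fin n → Fin m) : ℝ :=
  ∑ j, completionTime p s τ j

/-- `τ` is a pure Nash equilibrium: no job can decrease its completion time by
moving to another machine. -/
def IsNash {n m : ℕ} (p : Fin n → ℝ) (s : Fin m → ℝ) (τ : Fin n → Fin m) : Prop :=
  ∀ (j : Fin n) (i : Fin m),
    completionTime p s τ j ≤
      (p j + ∑ k ∈ univ.filter (fun k => k < j ∧ τ k = i), p k) / s i

/-- `ψ_i(τ, j)`: the number of jobs on machine `i` in schedule `τ` with strictly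
lower priority than job `j`. -/
def psi {n m : ℕ} (τ : Fin n → Fin m) (i : Fin m) (j : Fin n) : ℕ :=
  (univ.filter (fun k => j < k ∧ τ k = i)).card

/-- The coefficient of `p j` in the social cost of `σ`. -/
noncomputable def weight {n m : ℕ} (s : Fin m → ℝ) (σ : Fin n → Fin m) (j : Fin n) : ℝ :=
  (psi σ (σ j) j + 1) / s (σ j)

/-- Every job occupies a cheapest available position, when jobs are inserted from the last one
to the first. -/
def IsGreedy {n m : ℕ} (s : Fin m → ℝ) (σ : Fin n → Fin m) : Prop :=
  ∀ j i, weight s σ j ≤ (psi σ i j + 1) / s i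

lemma psi_cast_eq_sum {n m : ℕ} (σ : Fin n → Fin m) (i : Fin m) (j : Fin n) :
    (psi σ i j : ℝ) = ∑ k, if j < k ∧ σ k = i then 1 else 0 := by
  simp [psi]

lemma psi_succ {n m : ℕ} (σ : Fin (n + 1) → Fin m) (i : Fin m) (j : Fin n) :
    psi σ i j.succ = psi (σ ∘ Fin.succ) i j := by
  simp [psi, Finset.card_filter, Fin.sum_univ_succ, -Finset.sum_boole]

lemma psi_zero {n m : ℕ} (σ : Fin (n + 1) → Fin m) (i : Fin m) :
    psi σ i 0 = #{k | (σ ∘ Fin.succ) k = i} := by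
  simp [psi, Finset.card_filter, Fin.sum_univ_succ, -Finset.sum_boole]

lemma psi_antitone {n m : ℕ} (σ : Fin n → Fin m) (i : Fin m) : Antitone (psi σ i) := by
  intro j k hjk
  refine Finset.card_le_card fun l hl => ?_
  simp only [Finset.mem_filter, Finset.mem_univ, true_and] at hl ⊢
  exact ⟨hjk.trans_lt hl.1, hl.2⟩

lemma weight_succ {n m : ℕ} (s : Fin m → ℝ) (σ : Fin (n + 1) → Fin m) (j : Fin n) :
    weight s σ j.succ = weight s (σ ∘ Fin.succ) j := by
  simp [weight, psi_succ]

lemma IsGreedy.tail {n m : ℕ} {s : Fin m → ℝ} {σ : Fin (n + 1) → Fin m} (h : IsGreedy s σ) :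
    IsGreedy s (σ ∘ Fin.succ) := by
  intro j i
  simpa only [weight_succ, psi_succ] using h j.succ i

lemma exists_isGreedy {m : ℕ} [Nonempty (Fin m)] (s : Fin m → ℝ) (n : ℕ) :
    ∃ σ : Fin n → Fin m, IsGreedy s σ := by
  induction n with
  | zero => exact ⟨Fin.elim0, fun j => j.elim0⟩
  | succ n ih =>
    obtain ⟨σ, hσ⟩ := ih
    obtain ⟨i₀, hi₀⟩ := Finite.exists_min fun i => ((#{k | σ k = i} : ℕ) + 1 : ℝ) / s i
    have htail : (Fin.cons i₀ σ : Fin (n + 1) → Fin m) ∘ Fin.succ = σ := by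
      ext k; simp
    refine ⟨Fin.cons i₀ σ, fun j i => ?_⟩
    cases j using Fin.cases with
    | zero => simpa only [weight, psi_zero, htail, Fin.cons_zero] using hi₀ i
    | succ j => simpa only [weight_succ, psi_succ, htail] using hσ j i

lemma IsGreedy.psi_div_le_weight {n m : ℕ} {s : Fin m → ℝ} (hs : ∀ i, 0 < s i)
    {σ : Fin n → Fin m} (h : IsGreedy s σ) (i : Fin m) (j : Fin n) :
    psi σ i j / s i ≤ weight s σ j := by
  rcases (univ.filter fun k => j < k ∧ σ k = i).eq_empty_or_nonempty with he | hne
  · have : psi σ i j = 0 := by rw [psi, he, Finset.card_empty]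
    rw [this, weight]
    have := hs (σ j)
    simp only [Nat.cast_zero, zero_div]
    positivity
  · obtain ⟨k, hk, hmin⟩ := Finset.exists_min_image _ id hne
    simp only [Finset.mem_filter, Finset.mem_univ, true_and, id] at hk hmin
    obtain ⟨hjk, rfl⟩ := hk
    have hcard : psi σ (σ k) j ≤ psi σ (σ k) k + 1 := by
      rw [psi, psi, ← Finset.card_insert_of_notMem (a := k) (by simp)]
      refine Finset.card_le_card fun l hl => ?_
      simp only [Finset.mem_filter, Finset.mem_univ, true_and, Finset.mem_insert] at hl ⊢
      rcases (hmin l hl).eq_or_lt with h | h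
      · exact Or.inl h.symm
      · exact Or.inr ⟨h, hl.2⟩
    have hk := (hs (σ k)).le
    have hj := (hs (σ j)).le
    calc (psi σ (σ k) j : ℝ) / s (σ k) ≤ (psi σ (σ k) k + 1) / s (σ k) := by
          gcongr; exact_mod_cast hcard
      _ ≤ (psi σ (σ j) k + 1) / s (σ j) := h k (σ j)
      _ ≤ weight s σ j := by
          unfold weight; gcongr; exact psi_antitone σ _ hjk.le

lemma card_fiber_succ {n m : ℕ} (σ : Fin (n + 1) → Fin m) (i : Fin m) :
    #{k | σ k = i} = (if σ 0 = i then 1 else 0) + psi σ i 0 := by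
  simp [psi, Finset.card_filter, Fin.sum_univ_succ, -Finset.sum_boole]

lemma sum_weight {n m : ℕ} (s : Fin m → ℝ) (σ : Fin n → Fin m) :
    ∑ j, weight s σ j =
      ∑ i, ((#{k | σ k = i} : ℕ) : ℝ) * ((#{k | σ k = i} : ℕ) + 1) / 2 / s i := by
  induction n with
  | zero => simp
  | succ n ih =>
    have key : ∀ i, ((#{k | σ k = i} : ℕ) : ℝ) * ((#{k | σ k = i} : ℕ) + 1) / 2 / s i =
        (if σ 0 = i then (psi σ i 0 + 1 : ℝ) / s i else 0) +
          (psi σ i 0 : ℝ) * (psi σ i 0 + 1) / 2 / s i := by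
      intro i
      rw [card_fiber_succ]
      split_ifs <;> push_cast <;> ring
    rw [Fin.sum_univ_succ, Finset.sum_congr rfl fun i _ => key i, Finset.sum_add_distrib,
      Finset.sum_ite_eq]
    simp only [weight_succ, ih, psi_zero, Finset.mem_univ, if_true]
    rw [weight, psi_zero]

lemma triangular_sub_mul_le {a b : ℕ} {t : ℝ} (h₁ : a ≤ t) (h₂ : t ≤ a + 1) :
    (a : ℝ) * (a + 1) / 2 - a * t ≤ (b : ℝ) * (b + 1) / 2 - b * t := by
  rcases lt_trichotomy a b with h | rfl | h
  · have : (a : ℝ) + 1 ≤ b := by exact_mod_cast h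
    nlinarith
  · exact le_rfl
  · have : (b : ℝ) + 1 ≤ a := by exact_mod_cast h
    nlinarith

lemma sum_card_fiber {n m : ℕ} (σ : Fin n → Fin m) :
    ∑ i, ((#{k | σ k = i} : ℕ) : ℝ) = n := by
  rw [← Nat.cast_sum, ← Finset.card_eq_sum_card_fiberwise (by simp)]
  simp

lemma IsGreedy.sum_weight_le {n m : ℕ} {s : Fin m → ℝ} (hs : ∀ i, 0 < s i)
    {σ : Fin n → Fin m} (h : IsGreedy s σ) (ρ : Fin n → Fin m) :
    ∑ j, weight s σ j ≤ ∑ j, weight s ρ j := by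
  cases n with
  | zero => simp
  | succ n =>
    set T := weight s σ 0 with hT
    have key : ∀ i,
        ((#{k | σ k = i} : ℕ) : ℝ) * ((#{k | σ k = i} : ℕ) + 1) / 2 / s i
            - (#{k | σ k = i} : ℕ) * T ≤
          ((#{k | ρ k = i} : ℕ) : ℝ) * ((#{k | ρ k = i} : ℕ) + 1) / 2 / s i
            - (#{k | ρ k = i} : ℕ) * T := by
      intro i
      have hi := hs i
      have h₁ : ((#{k | σ k = i} : ℕ) : ℝ) ≤ T * s i := by
        rw [← div_le_iff₀ hi, card_fiber_succ]
        split_ifs with h0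
        · subst h0
          rw [hT, weight]
          push_cast
          rw [add_comm]
        · simpa using h.psi_div_le_weight hs i 0
      have h₂ : T * s i ≤ (#{k | σ k = i} : ℕ) + 1 := by
        refine ((le_div_iff₀ hi).1 (h 0 i)).trans ?_
        gcongr
        rw [card_fiber_succ]
        exact Nat.le_add_left _ _
      have := div_le_div_of_nonneg_right
        (triangular_sub_mul_le (b := #{k | ρ k = i}) h₁ h₂) hi.le
      simpa only [sub_div, ← mul_assoc, mul_div_cancel_right₀ _ hi.ne'] using this
    have hsum := Finset.sum_le_sum fun i (_ : i ∈ univ) => key i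
    simp only [Finset.sum_sub_distrib, ← Finset.sum_mul, sum_card_fiber] at hsum
    rw [sum_weight, sum_weight]
    linarith

lemma IsGreedy.sum_mul_weight_le {n m : ℕ} {s : Fin m → ℝ} (hs : ∀ i, 0 < s i)
    {p : Fin n → ℝ} (hp : ∀ j, 0 ≤ p j) (hpmono : Monotone p)
    {σ : Fin n → Fin m} (h : IsGreedy s σ) (ρ : Fin n → Fin m) :
    ∑ j, p j * weight s σ j ≤ ∑ j, p j * weight s ρ j := by
  induction n with
  | zero => simp
  | succ n ih =>
    have split : ∀ π : Fin (n + 1) → Fin m, ∑ j, p j * weight s π j =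
        p 0 * ∑ j, weight s π j +
          ∑ j : Fin n, (p j.succ - p 0) * weight s (π ∘ Fin.succ) j := by
      intro π
      simp only [Fin.sum_univ_succ, weight_succ, sub_mul, Finset.sum_sub_distrib,
        ← Finset.mul_sum]
      ring
    rw [split, split]
    refine add_le_add (mul_le_mul_of_nonneg_left (h.sum_weight_le hs ρ) (hp 0))
      (ih (fun j => sub_nonneg.2 (hpmono (Fin.zero_le _))) (fun j k hjk => ?_) h.tail _)
    exact sub_le_sub_right (hpmono (Fin.succ_le_succ_iff.2 hjk)) _

/-- Double counting of the waiting times incurred when jobs placed by `σ` queue behind the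
jobs placed by `τ`. -/
lemma sum_waiting_eq {n m : ℕ} (p : Fin n → ℝ) (s : Fin m → ℝ) (τ σ : Fin n → Fin m) :
    ∑ j, (∑ k ∈ univ.filter (fun k => k < j ∧ τ k = σ j), p k) / s (σ j) =
      ∑ k, p k * (psi σ (τ k) k / s (τ k)) := by
  simp only [psi_cast_eq_sum, Finset.sum_div, Finset.mul_sum, Finset.sum_filter]
  rw [Finset.sum_comm]
  refine Finset.sum_congr rfl fun k _ => Finset.sum_congr rfl fun j _ => ?_
  by_cases h : τ k = σ j
  · by_cases hkj : k < j <;> simp [h, hkj, div_eq_mul_inv]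
  · simp [h, Ne.symm h]

lemma completionTime_eq {n m : ℕ} (p : Fin n → ℝ) (s : Fin m → ℝ) (σ : Fin n → Fin m)
    (j : Fin n) :
    completionTime p s σ j =
      (p j + ∑ k ∈ univ.filter (fun k => k < j ∧ σ k = σ j), p k) / s (σ j) := by
  have : univ.filter (fun k => k ≤ j ∧ σ k = σ j) =
      insert j (univ.filter fun k => k < j ∧ σ k = σ j) := by
    ext k
    simp only [Finset.mem_filter, Finset.mem_univ, true_and, Finset.mem_insert, le_iff_eq_or_lt]
    constructor
    · rintro ⟨h | h, h'⟩
      · exact Or.inl h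
      · exact Or.inr ⟨h, h'⟩
    · rintro (rfl | ⟨h, h'⟩)
      · exact ⟨Or.inl rfl, rfl⟩
      · exact ⟨Or.inr h, h'⟩
  rw [completionTime, this, Finset.sum_insert (by simp)]

lemma socialCost_eq_sum_weight {n m : ℕ} (p : Fin n → ℝ) (s : Fin m → ℝ) (σ : Fin n → Fin m) :
    socialCost p s σ = ∑ j, p j * weight s σ j := by
  simp only [socialCost, completionTime_eq, add_div, Finset.sum_add_distrib, sum_waiting_eq,
    weight, mul_add]
  rw [add_comm]
  simp [div_eq_mul_inv]

lemma IsNash.socialCost_le_of_isGreedy {n m : ℕ} {p : Fin n → ℝ} {s : Fin m → ℝ}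
    (hp : ∀ j, 0 ≤ p j) (hs : ∀ i, 0 < s i) {τ σ : Fin n → Fin m}
    (hτ : IsNash p s τ) (hσ : IsGreedy s σ) :
    socialCost p s τ ≤ 2 * socialCost p s σ := by
  have hfirst : ∑ j, p j / s (σ j) ≤ ∑ j, p j * weight s σ j := by
    refine Finset.sum_le_sum fun j _ => ?_
    rw [weight, div_eq_mul_one_div]
    have := (hs (σ j)).le
    have := hp j
    gcongr
    simp
  calc socialCost p s τ
      ≤ ∑ j, (p j + ∑ k ∈ univ.filter (fun k => k < j ∧ τ k = σ j), p k) / s (σ j) :=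
        Finset.sum_le_sum fun j _ => hτ j (σ j)
    _ = ∑ j, p j / s (σ j) + ∑ k, p k * (psi σ (τ k) k / s (τ k)) := by
        simp only [add_div, Finset.sum_add_distrib, sum_waiting_eq]
    _ ≤ ∑ j, p j * weight s σ j + ∑ j, p j * weight s σ j :=
        add_le_add hfirst (Finset.sum_le_sum fun k _ =>
          mul_le_mul_of_nonneg_left (hσ.psi_div_le_weight hs _ _) (hp k))
    _ = 2 * socialCost p s σ := by rw [socialCost_eq_sum_weight, two_mul]

/-- Hoeksma–Uetz upper bound: the pure price of anarchy of `Q||ΣC_j` is at most 2: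
every pure Nash equilibrium `τ` and every schedule `σ` satisfy `SC(τ) ≤ 2·SC(σ)`. -/
theorem poa_le_two (n m : ℕ) (p : Fin n → ℝ) (s : Fin m → ℝ)
    (hp : ∀ j, 0 < p j) (hpmono : Monotone p) (hs : ∀ i, 0 < s i)
    (τ σ : Fin n → Fin m) (hτ : IsNash p s τ) :
    socialCost p s τ ≤ 2 * socialCost p s σ := by
  rcases n.eq_zero_or_pos with rfl | hn
  · simp [socialCost]
  have : Nonempty (Fin m) := ⟨τ ⟨0, hn⟩⟩
  obtain ⟨γ, hγ⟩ := exists_isGreedy s n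
  have hopt : socialCost p s γ ≤ socialCost p s σ := by
    rw [socialCost_eq_sum_weight, socialCost_eq_sum_weight]
    exact hγ.sum_mul_weight_le hs (fun j => (hp j).le) hpmono σ
  linarith [hτ.socialCost_le_of_isGreedy (fun j => (hp j).le) hs hγ]
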